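/- arXiv:1902.05133 — 2 statements merged into one kernel-verified Lean document; each statement's English description precedes it below -/
import Mathlib

section
/- Let X ⊂ P³(K) be a smooth surface of degree d ≥ 3 over an algebraically closed field K of characteristic 0 or of characteristic p > d. If L ⊆ X is a line of the first kind, then the number of lines L' ⊆ X with L' ≠ L and L' ∩ L ≠ ∅ is at most 8d − 14. -/
open MvPolynomial

/-- The restriction of the polynomial `g` to the line through `[u]` spanned by `u` and `v`,
under the linear parametrization `t ↦ u + t • v`. -/
noncomputable def restrictLine {K : Type*} [CommSemiring K] {n : ℕ}
    (g : MvPolynomial (Fin n) K) (u v : Fin n → K) : Polynomial K :=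
  MvPolynomial.aeval (fun i => Polynomial.C (u i) + Polynomial.X * Polynomial.C (v i)) g

/-- `ordGE g u v k` means: the order of vanishing at the point `P = [u]` of the restriction
of `g` to the line spanned by `u` and `v` is at least `k` (this includes the case of the
identically vanishing restriction, i.e. order `∞`). -/
def ordGE {K : Type*} [CommSemiring K] {n : ℕ}
    (g : MvPolynomial (Fin n) K) (u v : Fin n → K) (k : ℕ) : Prop :=
  ∀ j < k, (restrictLine g u v).coeff j = 0

/-- `f` defines a smooth surface of degree `d` in `ℙ³(K)`: `f` is homogeneous of degree `d`
and its four partial derivatives have no common zero in `ℙ³(K)`. -/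
def IsSmoothSurfaceOfDegree {K : Type*} [CommSemiring K]
    (f : MvPolynomial (Fin 4) K) (d : ℕ) : Prop :=
  f.IsHomogeneous d ∧
    ∀ w : Fin 4 → K, w ≠ 0 → ∃ i : Fin 4, MvPolynomial.eval w (MvPolynomial.pderiv i f) ≠ 0

/-- A line in `ℙ³(K)` (the projectivization of a 2-dimensional linear subspace `W` of `K⁴`)
that is contained in the surface `{f = 0}`. -/
def IsLineInSurface {K : Type*} [Field K]
    (f : MvPolynomial (Fin 4) K) (W : Submodule K (Fin 4 → K)) : Prop :=
  Module.finrank K W = 2 ∧ ∀ v ∈ W, MvPolynomial.eval v f = 0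

/-- `q` is an inflection point of the plane curve `{g = 0} ⊆ ℙ²(K)`: some line `L'` through `q`
meets the curve with multiplicity at least `3` at `q`, or is contained in the curve. -/
def IsInflectionPointAt {K : Type*} [Field K]
    (g : MvPolynomial (Fin 3) K) (q : Fin 3 → K) : Prop :=
  ∃ w : Fin 3 → K, LinearIndependent K ![q, w] ∧
    (ordGE g q w 3 ∨ ∀ s t : K, MvPolynomial.eval (s • q + t • w) g = 0)

/-- The defining condition for a line `L` (given by the subspace `W`) to be of the second kind:
for every plane `Π = span{a,b,c} ⊇ L = span{a,b}` with residual curve `Γ_Π = {g = 0}`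
(where `f|_Π = z · g` in the coordinates `(x,y,z)` on `Π`), every point of `L ∩ Γ_Π`
is an inflection point of `Γ_Π`. -/
def SecondKindCond {K : Type*} [Field K]
    (f : MvPolynomial (Fin 4) K) (d : ℕ) (W : Submodule K (Fin 4 → K)) : Prop :=
  ∀ a b c : Fin 4 → K, a ∈ W → b ∈ W → LinearIndependent K ![a, b, c] →
    ∀ g : MvPolynomial (Fin 3) K, g.IsHomogeneous (d - 1) →
      (∀ x y z : K,
          MvPolynomial.eval (x • a + y • b + z • c) f = z * MvPolynomial.eval ![x, y, z] g) →
      ∀ s t : K, (s ≠ 0 ∨ t ≠ 0) → MvPolynomial.eval ![s, t, 0] g = 0 →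
        IsInflectionPointAt g ![s, t, 0]

/-- A line of the second kind on the surface `{f = 0}`. -/
def IsLineOfSecondKind {K : Type*} [Field K]
    (f : MvPolynomial (Fin 4) K) (d : ℕ) (W : Submodule K (Fin 4 → K)) : Prop :=
  IsLineInSurface f W ∧ SecondKindCond f d W

/-- A line of the first kind on the surface `{f = 0}`. -/
def IsLineOfFirstKind {K : Type*} [Field K]
    (f : MvPolynomial (Fin 4) K) (d : ℕ) (W : Submodule K (Fin 4 → K)) : Prop :=
  IsLineInSurface f W ∧ ¬ SecondKindCond f d W

section HessianPolynomial

variable {K : Type*} [Field K]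

/-- Twice the second-order obstruction to inflection, along the line `y = z = 0`, of the residual
curves cut out by the tangent planes of the affine surface
`y A + z B + (y² C + y z D + z² E) + (y³ G + y² z G' + y z² G'' + z³ G''') + ⋯ = 0`. -/
noncomputable def tangentHessian (A B C D E G G' G'' G''' : Polynomial K) : Polynomial K :=
  (B * A.derivative.derivative - A * B.derivative.derivative) *
      (C * B ^ 2 - D * (A * B) + E * A ^ 2) ^ 2 -
    2 * (B * A.derivative - A * B.derivative) * (C * B ^ 2 - D * (A * B) + E * A ^ 2) *
      (C.derivative * B ^ 2 - D.derivative * (A * B) + E.derivative * A ^ 2) +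
    2 * (G * B ^ 3 - G' * (B ^ 2 * A) + G'' * (B * A ^ 2) - G''' * A ^ 3) *
      (B * A.derivative - A * B.derivative) ^ 2

theorem natDegree_euler_le {P : Polynomial K} {k : ℕ} (hP : P.natDegree ≤ k + 1) :
    (((k + 1 : ℕ) : Polynomial K) * P - Polynomial.X * P.derivative).natDegree ≤ k := by
  rw [Polynomial.natDegree_le_iff_coeff_eq_zero]
  intro N hN
  obtain ⟨N, rfl⟩ : ∃ M, N = M + 1 := ⟨N - 1, by omega⟩
  rw [Polynomial.coeff_sub, Polynomial.coeff_X_mul, Polynomial.coeff_derivative,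
    Polynomial.coeff_natCast_mul]
  rcases Nat.lt_or_ge k N with h | h
  · rw [Polynomial.coeff_eq_zero_of_natDegree_lt (by omega)]; simp
  · obtain rfl : N = k := by omega
    push_cast; ring

theorem natDegree_tangentHessian_le {A B C D E G G' G'' G''' : Polynomial K} {k : ℕ}
    (hk : ((k + 1 : ℕ) : K) ≠ 0)
    (hA : A.natDegree ≤ k + 2) (hB : B.natDegree ≤ k + 2)
    (hC : C.natDegree ≤ k + 1) (hD : D.natDegree ≤ k + 1) (hE : E.natDegree ≤ k + 1)
    (hG : G.natDegree ≤ k) (hG' : G'.natDegree ≤ k) (hG'' : G''.natDegree ≤ k)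
    (hG''' : G'''.natDegree ≤ k) :
    (tangentHessian A B C D E G G' G'' G''').natDegree ≤ 8 * k + 10 := by
  have hder : ∀ {P : Polynomial K} {m : ℕ}, P.natDegree ≤ m + 1 → P.derivative.natDegree ≤ m :=
    fun {P m} h => (Polynomial.natDegree_derivative_le P).trans (by omega)
  have hmul : ∀ {P Q : Polynomial K} {m n : ℕ} (l : ℕ), P.natDegree ≤ m → Q.natDegree ≤ n →
      m + n ≤ l → (P * Q).natDegree ≤ l :=
    fun l h₁ h₂ h => (Polynomial.natDegree_mul_le_of_le h₁ h₂).trans h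
  have hadd : ∀ {P Q : Polynomial K} {m : ℕ}, P.natDegree ≤ m → Q.natDegree ≤ m →
      (P + Q).natDegree ≤ m := fun h₁ h₂ => Polynomial.natDegree_add_le_of_degree_le h₁ h₂
  have hsub : ∀ {P Q : Polynomial K} {m : ℕ}, P.natDegree ≤ m → Q.natDegree ≤ m →
      (P - Q).natDegree ≤ m := fun h₁ h₂ =>
    (Polynomial.natDegree_sub_le_of_le h₁ h₂).trans (by simp)
  set x : Polynomial K → ℕ → Polynomial K :=
    fun P m => ((m + 1 : ℕ) : Polynomial K) * P - Polynomial.X * P.derivative with hx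
  have hxdeg : ∀ {P : Polynomial K} {m : ℕ}, P.natDegree ≤ m + 1 → (x P m).natDegree ≤ m :=
    fun h => natDegree_euler_le h
  have hA' := hder hA
  have hB' := hder hB
  have hAyy := hder hA'
  have hByy := hder hB'
  have hAxy := hxdeg hA'
  have hBxy := hxdeg hB'
  have hAxx := hxdeg (hxdeg hA)
  have hBxx := hxdeg (hxdeg hB)
  have hBA : (A * B).natDegree ≤ 2 * k + 4 := hmul _ hA hB (by omega)
  have hA2 : (A ^ 2).natDegree ≤ 2 * k + 4 := by rw [pow_two]; exact hmul _ hA hA (by omega)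
  have hB2 : (B ^ 2).natDegree ≤ 2 * k + 4 := by rw [pow_two]; exact hmul _ hB hB (by omega)
  have hA3 : (A ^ 3).natDegree ≤ 3 * k + 6 := by rw [pow_succ]; exact hmul _ hA2 hA (by omega)
  have hB3 : (B ^ 3).natDegree ≤ 3 * k + 6 := by rw [pow_succ]; exact hmul _ hB2 hB (by omega)
  have hB2A : (B ^ 2 * A).natDegree ≤ 3 * k + 6 := hmul _ hB2 hA (by omega)
  have hBA2 : (B * A ^ 2).natDegree ≤ 3 * k + 6 := hmul _ hB hA2 (by omega)
  have pencil : ∀ {P Q : Polynomial K}, P.natDegree ≤ k → Q.natDegree ≤ k →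
      (B * P - A * Q).natDegree ≤ 2 * k + 2 := fun h₁ h₂ =>
    hsub (hmul _ hB h₁ (by omega)) (hmul _ hA h₂ (by omega))
  have quad : ∀ {P Q R : Polynomial K}, P.natDegree ≤ k → Q.natDegree ≤ k → R.natDegree ≤ k →
      (P * B ^ 2 - Q * (A * B) + R * A ^ 2).natDegree ≤ 3 * k + 4 := fun h₁ h₂ h₃ =>
    hadd (hsub (hmul _ h₁ hB2 (by omega)) (hmul _ h₂ hBA (by omega))) (hmul _ h₃ hA2 (by omega))
  have hyy := pencil hAyy hByy
  have hxy := pencil hAxy hBxy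
  have hxx := pencil hAxx hBxx
  have hyz := quad (hder hC) (hder hD) (hder hE)
  have hxz := quad (hxdeg hC) (hxdeg hD) (hxdeg hE)
  have hzz : (2 * (G * B ^ 3 - G' * (B ^ 2 * A) + G'' * (B * A ^ 2) - G''' * A ^ 3)).natDegree ≤
      4 * k + 6 :=
    hmul (m := 0) _ (Polynomial.natDegree_ofNat (R := K) 2).le
      (hsub (hadd (hsub (hmul (4 * k + 6) hG hB3 (by omega)) (hmul _ hG' hB2A (by omega)))
        (hmul _ hG'' hBA2 (by omega))) (hmul _ hG''' hA3 (by omega))) (by omega)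
  have hdet : (Polynomial.C (-((k + 1 : ℕ) : K) ^ 2) *
      tangentHessian A B C D E G G' G'' G''').natDegree ≤ 8 * k + 10 := by
    have key : Polynomial.C (-((k + 1 : ℕ) : K) ^ 2) * tangentHessian A B C D E G G' G'' G''' =
        (B * x (x A (k + 1)) k - A * x (x B (k + 1)) k) *
          ((B * A.derivative.derivative - A * B.derivative.derivative) *
            (2 * (G * B ^ 3 - G' * (B ^ 2 * A) + G'' * (B * A ^ 2) - G''' * A ^ 3)) -
            (C.derivative * B ^ 2 - D.derivative * (A * B) + E.derivative * A ^ 2) *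
            (C.derivative * B ^ 2 - D.derivative * (A * B) + E.derivative * A ^ 2)) -
        (B * x A.derivative k - A * x B.derivative k) *
          ((B * x A.derivative k - A * x B.derivative k) *
            (2 * (G * B ^ 3 - G' * (B ^ 2 * A) + G'' * (B * A ^ 2) - G''' * A ^ 3)) -
            (C.derivative * B ^ 2 - D.derivative * (A * B) + E.derivative * A ^ 2) *
            (x C k * B ^ 2 - x D k * (A * B) + x E k * A ^ 2)) +
        (x C k * B ^ 2 - x D k * (A * B) + x E k * A ^ 2) *
          ((B * x A.derivative k - A * x B.derivative k) *
            (C.derivative * B ^ 2 - D.derivative * (A * B) + E.derivative * A ^ 2) -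
            (B * A.derivative.derivative - A * B.derivative.derivative) *
            (x C k * B ^ 2 - x D k * (A * B) + x E k * A ^ 2)) := by
      simp only [hx, tangentHessian, Polynomial.derivative_sub, Polynomial.derivative_mul,
        Polynomial.derivative_X, Polynomial.derivative_natCast, map_neg, map_pow, map_natCast]
      push_cast
      ring
    rw [key]
    refine hadd (hsub (hmul (n := 6 * k + 8) _ hxx (hsub (hmul _ hyy hzz (by omega))
      (hmul _ hyz hyz (by omega))) (by omega)) (hmul (n := 6 * k + 8) _ hxy (hsub
      (hmul _ hxy hzz (by omega)) (hmul _ hyz hxz (by omega))) (by omega)))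
      (hmul (n := 5 * k + 6) _ hxz (hsub (hmul _ hxy hyz (by omega)) (hmul _ hyy hxz (by omega)))
        (by omega))
  rwa [Polynomial.natDegree_C_mul (neg_ne_zero.2 (pow_ne_zero 2 hk))] at hdet

/-- Expansion of `tangentHessian` around the tangent plane `z = -ρ y`. -/
theorem tangentHessian_eq (A B C D E G G' G'' G''' : Polynomial K) (ρ : K)
    {A₀ C₀ G₀ : Polynomial K} (hA₀ : A₀ = A - Polynomial.C ρ * B)
    (hC₀ : C₀ = C - Polynomial.C ρ * D + Polynomial.C ρ ^ 2 * E)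
    (hG₀ : G₀ = G - Polynomial.C ρ * G' + Polynomial.C ρ ^ 2 * G'' - Polynomial.C ρ ^ 3 * G''') :
    ∃ S T U : Polynomial K, tangentHessian A B C D E G G' G'' G''' =
      (B * A₀.derivative.derivative - A₀ * B.derivative.derivative) * (B ^ 2 * C₀ + A₀ * S) ^ 2 -
        2 * (B * A₀.derivative - A₀ * B.derivative) * (B ^ 2 * C₀ + A₀ * S) *
          (B ^ 2 * C₀.derivative + A₀ * T) +
        2 * (B ^ 3 * G₀ + A₀ * U) * (B * A₀.derivative - A₀ * B.derivative) ^ 2 := by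
  obtain rfl : A = A₀ + Polynomial.C ρ * B := by rw [hA₀]; ring
  obtain rfl : C = C₀ + Polynomial.C ρ * D - Polynomial.C ρ ^ 2 * E := by rw [hC₀]; ring
  obtain rfl : G = G₀ + Polynomial.C ρ * G' - Polynomial.C ρ ^ 2 * G'' + Polynomial.C ρ ^ 3 * G''' :=
    by rw [hG₀]; ring
  refine ⟨-D * B + E * (A₀ + 2 * Polynomial.C ρ * B),
    -D.derivative * B + E.derivative * (A₀ + 2 * Polynomial.C ρ * B),
    -G' * B ^ 2 + G'' * B * (A₀ + 2 * Polynomial.C ρ * B) -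
      G''' * (A₀ ^ 2 + 3 * A₀ * (Polynomial.C ρ * B) + 3 * (Polynomial.C ρ * B) ^ 2), ?_⟩
  simp only [tangentHessian, Polynomial.derivative_add, Polynomial.derivative_sub,
    Polynomial.derivative_mul, Polynomial.derivative_C, Polynomial.derivative_pow,
    Polynomial.derivative_zero, mul_zero]
  ring

theorem eval_tangentHessian {A B C D E G G' G'' G''' : Polynomial K} (ρ τ : K)
    {A₀ C₀ G₀ : Polynomial K} (hA₀ : A₀ = A - Polynomial.C ρ * B)
    (hC₀ : C₀ = C - Polynomial.C ρ * D + Polynomial.C ρ ^ 2 * E)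
    (hG₀ : G₀ = G - Polynomial.C ρ * G' + Polynomial.C ρ ^ 2 * G'' - Polynomial.C ρ ^ 3 * G''')
    (hτ : A₀.eval τ = 0) :
    (tangentHessian A B C D E G G' G'' G''').eval τ =
      B.eval τ ^ 5 * (A₀.derivative.derivative.eval τ * C₀.eval τ ^ 2 -
        2 * A₀.derivative.eval τ * C₀.eval τ * C₀.derivative.eval τ +
        2 * G₀.eval τ * A₀.derivative.eval τ ^ 2) := by
  obtain ⟨S, T, U, h⟩ := tangentHessian_eq A B C D E G G' G'' G''' ρ hA₀ hC₀ hG₀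
  rw [h]
  simp only [Polynomial.eval_add, Polynomial.eval_sub, Polynomial.eval_mul, Polynomial.eval_pow, hτ,
    Polynomial.eval_ofNat]
  ring

theorem pow_dvd_tangentHessian {A B C D E G G' G'' G''' : Polynomial K} (ρ : K)
    {A₀ C₀ G₀ π : Polynomial K} (hA₀ : A₀ = A - Polynomial.C ρ * B)
    (hC₀ : C₀ = C - Polynomial.C ρ * D + Polynomial.C ρ ^ 2 * E)
    (hG₀ : G₀ = G - Polynomial.C ρ * G' + Polynomial.C ρ ^ 2 * G'' - Polynomial.C ρ ^ 3 * G''')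
    {k : ℕ} (hk : 2 ≤ k) (hA : π ^ k ∣ A₀) (hC : π ^ (k - 1) ∣ C₀) (hG : π ^ (k - 2) ∣ G₀) :
    π ^ k ∣ tangentHessian A B C D E G G' G'' G''' := by
  obtain ⟨S, T, U, h⟩ := tangentHessian_eq A B C D E G G' G'' G''' ρ hA₀ hC₀ hG₀
  obtain ⟨k, rfl⟩ := Nat.exists_eq_add_of_le' hk
  have hA' := Polynomial.pow_sub_one_dvd_derivative_of_pow_dvd hA
  have hA'' := Polynomial.pow_sub_one_dvd_derivative_of_pow_dvd hA'
  have hC' := Polynomial.pow_sub_one_dvd_derivative_of_pow_dvd hC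
  simp only [Nat.add_sub_cancel, show k + 2 - 1 = k + 1 by omega] at hA' hA'' hC' hC hG
  have hA1 : π ^ (k + 1) ∣ A₀ := (pow_dvd_pow π (by omega)).trans hA
  have hA0 : π ^ k ∣ A₀ := (pow_dvd_pow π (by omega)).trans hA
  have h₂ : π ^ k ∣ B * A₀.derivative.derivative - A₀ * B.derivative.derivative :=
    dvd_sub (hA''.mul_left _) (hA0.mul_right _)
  have h₁ : π ^ (k + 1) ∣ B * A₀.derivative - A₀ * B.derivative :=
    dvd_sub (hA'.mul_left _) (hA1.mul_right _)
  have hq : π ^ (k + 1) ∣ B ^ 2 * C₀ + A₀ * S := dvd_add (hC.mul_left _) (hA1.mul_right _)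
  have hq' : π ^ k ∣ B ^ 2 * C₀.derivative + A₀ * T := dvd_add (hC'.mul_left _) (hA0.mul_right _)
  have hr : π ^ k ∣ B ^ 3 * G₀ + A₀ * U := dvd_add (hG.mul_left _) (hA0.mul_right _)
  have hpow : π ^ (k + 2) ∣ π ^ k * (π ^ (k + 1)) ^ 2 := by
    rw [← pow_mul, ← pow_add]; exact pow_dvd_pow π (by omega)
  rw [h]
  refine dvd_add (dvd_sub (hpow.trans (mul_dvd_mul h₂ (pow_dvd_pow_of_dvd hq 2))) ?_)
    (hpow.trans (mul_dvd_mul (hr.mul_left 2) (pow_dvd_pow_of_dvd h₁ 2)))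
  rw [show π ^ k * (π ^ (k + 1)) ^ 2 = π ^ (k + 1) * π ^ (k + 1) * π ^ k by ring] at hpow
  exact hpow.trans (mul_dvd_mul (mul_dvd_mul (h₁.mul_left 2) hq) hq')

end HessianPolynomial

section SliceExpansion

variable {K : Type*} [Field K]

/-- The coefficient of `y ^ j * z ^ l` in `h (1, x, y, z)`, as a polynomial in `x`. -/
noncomputable def sliceCoeff (h : MvPolynomial (Fin 4) K) (j l : ℕ) : Polynomial K :=
  ∑ m ∈ h.support, if m 2 = j ∧ m 3 = l then Polynomial.monomial (m 1) (h.coeff m) else 0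

/-- The coefficient of `y ^ j` in `h (1, x, y, -ρ y)`, as a polynomial in `x`. -/
noncomputable def planeCoeff (h : MvPolynomial (Fin 4) K) (ρ : K) (j : ℕ) : Polynomial K :=
  ∑ p ∈ Finset.HasAntidiagonal.antidiagonal j, sliceCoeff h p.1 p.2 * Polynomial.C ((-ρ) ^ p.2)

theorem MvPolynomial.IsHomogeneous.sum_eq_of_coeff_ne_zero {h : MvPolynomial (Fin 4) K} {d : ℕ}
    (hh : h.IsHomogeneous d) {m : Fin 4 →₀ ℕ} (hm : h.coeff m ≠ 0) :
    m 0 + m 1 + m 2 + m 3 = d := by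
  rw [← Fin.sum_univ_four, ← hh hm, Finsupp.weight_apply, Finsupp.sum_fintype _ _ (by simp)]
  simp

theorem natDegree_sliceCoeff_le {h : MvPolynomial (Fin 4) K} {d : ℕ} (hh : h.IsHomogeneous d)
    {j l k : ℕ} (hk : d ≤ j + l + k) : (sliceCoeff h j l).natDegree ≤ k := by
  refine Polynomial.natDegree_sum_le_of_forall_le _ _ fun m hm => ?_
  have := hh.sum_eq_of_coeff_ne_zero (mem_support_iff.1 hm)
  split_ifs with hjl
  · exact (Polynomial.natDegree_monomial_le _).trans (by omega)
  · simp

theorem aeval_eq_sum_sliceCoeff {h : MvPolynomial (Fin 4) K} {d : ℕ} (hh : h.IsHomogeneous d)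
    {R : Type*} [CommRing R] [Algebra K R] (x y z : R) :
    aeval ![1, x, y, z] h = ∑ j ∈ Finset.range (d + 1), ∑ p ∈ Finset.HasAntidiagonal.antidiagonal j,
      Polynomial.aeval x (sliceCoeff h p.1 p.2) * y ^ p.1 * z ^ p.2 := by
  have hsum : ∀ j l, Polynomial.aeval x (sliceCoeff h j l) * y ^ j * z ^ l =
      ∑ m ∈ h.support, if m 2 = j ∧ m 3 = l then
        algebraMap K R (h.coeff m) * x ^ m 1 * y ^ m 2 * z ^ m 3 else 0 := by
    intro j l
    rw [sliceCoeff, map_sum, Finset.sum_mul, Finset.sum_mul]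
    refine Finset.sum_congr rfl fun m _ => ?_
    split_ifs with hjl
    · rw [Polynomial.aeval_monomial, hjl.1, hjl.2]
    · simp
  simp only [hsum]
  rw [aeval_def, eval₂_eq']
  rw [Finset.sum_congr rfl fun j _ => Finset.sum_comm, Finset.sum_comm]
  refine Finset.sum_congr rfl fun m hm => ?_
  have hd := hh.sum_eq_of_coeff_ne_zero (mem_support_iff.1 hm)
  rw [Finset.sum_eq_single (m 2 + m 3), Finset.sum_eq_single (m 2, m 3)]
  · simp [Fin.prod_univ_four, mul_assoc]
  · rintro ⟨p, q⟩ _ hpq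
    exact if_neg fun h => hpq (by simp [h.1, h.2])
  · simp
  · intro j _ hj
    refine Finset.sum_eq_zero fun p hp => if_neg fun h => hj ?_
    rw [h.1, h.2, Finset.HasAntidiagonal.mem_antidiagonal.1 hp]
  · intro h
    exact absurd (Finset.mem_range.2 (by omega)) h

theorem aeval_eq_sum_planeCoeff {h : MvPolynomial (Fin 4) K} {d : ℕ} (hh : h.IsHomogeneous d)
    {R : Type*} [CommRing R] [Algebra K R] (ρ : K) (x y : R) :
    aeval ![1, x, y, -(algebraMap K R ρ * y)] h =
      ∑ j ∈ Finset.range (d + 1), Polynomial.aeval x (planeCoeff h ρ j) * y ^ j := by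
  rw [aeval_eq_sum_sliceCoeff hh]
  refine Finset.sum_congr rfl fun j _ => ?_
  rw [planeCoeff, map_sum, Finset.sum_mul]
  refine Finset.sum_congr rfl fun p hp => ?_
  rw [← Finset.HasAntidiagonal.mem_antidiagonal.1 hp, map_mul, Polynomial.aeval_C]
  simp only [map_pow, map_neg]
  ring

theorem planeCoeff_zero (h : MvPolynomial (Fin 4) K) (ρ : K) :
    planeCoeff h ρ 0 = sliceCoeff h 0 0 := by
  simp [planeCoeff]

theorem planeCoeff_one (h : MvPolynomial (Fin 4) K) (ρ : K) :
    planeCoeff h ρ 1 = sliceCoeff h 1 0 - Polynomial.C ρ * sliceCoeff h 0 1 := by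
  rw [planeCoeff, Finset.Nat.sum_antidiagonal_eq_sum_range_succ_mk]
  simp [Finset.sum_range_succ]
  ring

theorem planeCoeff_two (h : MvPolynomial (Fin 4) K) (ρ : K) :
    planeCoeff h ρ 2 = sliceCoeff h 2 0 - Polynomial.C ρ * sliceCoeff h 1 1 +
      Polynomial.C ρ ^ 2 * sliceCoeff h 0 2 := by
  rw [planeCoeff, Finset.Nat.sum_antidiagonal_eq_sum_range_succ_mk]
  simp [Finset.sum_range_succ]
  ring

theorem planeCoeff_three (h : MvPolynomial (Fin 4) K) (ρ : K) :
    planeCoeff h ρ 3 = sliceCoeff h 3 0 - Polynomial.C ρ * sliceCoeff h 2 1 +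
      Polynomial.C ρ ^ 2 * sliceCoeff h 1 2 - Polynomial.C ρ ^ 3 * sliceCoeff h 0 3 := by
  rw [planeCoeff, Finset.Nat.sum_antidiagonal_eq_sum_range_succ_mk]
  simp [Finset.sum_range_succ]
  ring

/-- `tangentHessian` of the surface `h (1, x, y, z) = 0`. -/
noncomputable def surfaceHessian (h : MvPolynomial (Fin 4) K) : Polynomial K :=
  tangentHessian (sliceCoeff h 1 0) (sliceCoeff h 0 1) (sliceCoeff h 2 0) (sliceCoeff h 1 1)
    (sliceCoeff h 0 2) (sliceCoeff h 3 0) (sliceCoeff h 2 1) (sliceCoeff h 1 2) (sliceCoeff h 0 3)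

theorem natDegree_surfaceHessian_le {h : MvPolynomial (Fin 4) K} {k : ℕ}
    (hh : h.IsHomogeneous (k + 3)) (hk : ((k + 1 : ℕ) : K) ≠ 0) :
    (surfaceHessian h).natDegree ≤ 8 * k + 10 := by
  apply natDegree_tangentHessian_le hk <;> exact natDegree_sliceCoeff_le hh (by omega)

/-- The coefficient of `X ^ n` in the restriction to a line of a polynomial in two variables. -/
theorem coeff_sum_aeval_mul_X_pow (φ : ℕ → Polynomial K) (d n : ℕ) (τ σ v : K) :
    (∑ j ∈ Finset.range (d + 1), Polynomial.aeval (Polynomial.C τ + Polynomial.C σ * Polynomial.X)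
      (φ j) * (Polynomial.C v * Polynomial.X) ^ j).coeff n =
    ∑ j ∈ Finset.range (d + 1), if j ≤ n then
      (Polynomial.taylor τ (φ j)).coeff (n - j) * σ ^ (n - j) * v ^ j else 0 := by
  have hcomp : ∀ P : Polynomial K,
      Polynomial.aeval (Polynomial.C τ + Polynomial.C σ * Polynomial.X) P =
        (Polynomial.taylor τ P).comp (Polynomial.C σ * Polynomial.X) := by
    intro P
    rw [Polynomial.taylor_apply, Polynomial.comp_assoc, Polynomial.aeval_def]
    simp [Polynomial.comp, add_comm]
  rw [Polynomial.finsetSum_coeff]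
  refine Finset.sum_congr rfl fun j _ => ?_
  rw [mul_pow, ← mul_assoc, Polynomial.coeff_mul_X_pow', ← Polynomial.C_pow,
    Polynomial.coeff_mul_C, hcomp, Polynomial.comp_C_mul_X_coeff]

/-- If `y ↦ ∑ⱼ φⱼ(τ + σ y) yʲ` vanishes for every `σ` in a finite set `s`, then `∑ⱼ φⱼ yʲ`
vanishes to order at least `#s` at `(τ, 0)`. -/
theorem pow_dvd_of_sum_aeval_eq_zero (φ : ℕ → Polynomial K) (d : ℕ) (τ : K) (s : Finset K)
    (hs : ∀ σ ∈ s, ∑ j ∈ Finset.range (d + 1), Polynomial.aeval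
      (Polynomial.C τ + Polynomial.C σ * Polynomial.X) (φ j) * Polynomial.X ^ j = 0)
    (j : ℕ) (hj : j ≤ d) : (Polynomial.X - Polynomial.C τ) ^ (s.card - j) ∣ φ j := by
  have hX : (Polynomial.X : Polynomial K) ^ (s.card - j) ∣ Polynomial.taylor τ (φ j) := by
    rw [Polynomial.X_pow_dvd_iff]
    intro i hi
    set Q : Polynomial K := ∑ l ∈ Finset.range (d + 1), if l ≤ i + j then
      Polynomial.monomial (i + j - l) ((Polynomial.taylor τ (φ l)).coeff (i + j - l)) else 0 with hQ
    have hQ0 : Q = 0 := by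
      refine Polynomial.eq_zero_of_natDegree_lt_card_of_eval_eq_zero' Q s (fun σ hσ => ?_) ?_
      · have := coeff_sum_aeval_mul_X_pow φ d (i + j) τ σ 1
        simp only [map_one, one_mul, hs σ hσ, one_pow, mul_one, Polynomial.coeff_zero] at this
        rw [this, hQ, Polynomial.eval_finsetSum]
        refine Finset.sum_congr rfl fun l _ => ?_
        split_ifs <;> simp [Polynomial.eval_monomial]
      · refine lt_of_le_of_lt (Polynomial.natDegree_sum_le_of_forall_le (n := i + j) _ _
          fun l _ => ?_) (by omega)
        split_ifs
        · exact (Polynomial.natDegree_monomial_le _).trans (by omega)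
        · simp
    have hc : Q.coeff i = (Polynomial.taylor τ (φ j)).coeff i := by
      rw [hQ, Polynomial.finsetSum_coeff, Finset.sum_eq_single j]
      · simp
      · intro l _ hlj
        split_ifs
        · rw [Polynomial.coeff_monomial, if_neg (by omega)]
        · simp
      · intro h; exact absurd (Finset.mem_range.2 (by omega)) h
    rw [← hc, hQ0, Polynomial.coeff_zero]
  obtain ⟨q, hq⟩ := hX
  refine ⟨Polynomial.taylor (-τ) q, ?_⟩
  have := congrArg (Polynomial.taylor (-τ)) hq
  rwa [Polynomial.taylor_taylor, neg_add_cancel, Polynomial.taylor_zero, Polynomial.taylor_mul,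
    Polynomial.taylor_pow, Polynomial.taylor_X, map_neg, ← sub_eq_add_neg] at this

end SliceExpansion

section Counting

variable {K : Type*} [Field K]

theorem two_mul_taylor_coeff_two (P : Polynomial K) (τ : K) :
    2 * (Polynomial.taylor τ P).coeff 2 = P.derivative.derivative.eval τ := by
  have := congrArg (Polynomial.eval τ) (congrFun (Polynomial.factorial_smul_hasseDeriv (R := K) 2) P)
  simpa [Polynomial.taylor_coeff, Function.iterate_succ] using this

theorem X_sub_C_pow_dvd_surfaceHessian {h : MvPolynomial (Fin 4) K} {d : ℕ}
    (hh : h.IsHomogeneous d) (hd : 3 ≤ d) (h₀ : sliceCoeff h 0 0 = 0) (τ ρ : K)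
    (hρ : (sliceCoeff h 1 0).eval τ = ρ * (sliceCoeff h 0 1).eval τ) (s : Finset K)
    (hs : ∀ σ ∈ s, aeval ![1, Polynomial.C τ + Polynomial.C σ * Polynomial.X, Polynomial.X,
      -(Polynomial.C ρ * Polynomial.X)] h = 0) :
    (Polynomial.X - Polynomial.C τ) ^ s.card ∣ surfaceHessian h := by
  have hs' : ∀ σ ∈ s, ∑ j ∈ Finset.range (d + 1), Polynomial.aeval
      (Polynomial.C τ + Polynomial.C σ * Polynomial.X) (planeCoeff h ρ j) * Polynomial.X ^ j = 0 :=
    fun σ hσ => (aeval_eq_sum_planeCoeff hh ρ _ _).symm.trans (hs σ hσ)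
  obtain ⟨e, rfl⟩ := Nat.exists_eq_add_of_le' hd
  replace hs' : ∀ σ ∈ s, ∑ j ∈ Finset.range (e + 2 + 1), Polynomial.aeval
      (Polynomial.C τ + Polynomial.C σ * Polynomial.X) (planeCoeff h ρ (j + 1)) *
        Polynomial.X ^ j = 0 := by
    intro σ hσ
    have := hs' σ hσ
    rw [Finset.sum_range_succ', planeCoeff_zero, h₀, map_zero, zero_mul, add_zero] at this
    simp only [pow_succ, ← mul_assoc, ← Finset.sum_mul] at this
    exact (mul_eq_zero.1 this).resolve_right Polynomial.X_ne_zero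
  have hdvd := pow_dvd_of_sum_aeval_eq_zero (fun j => planeCoeff h ρ (j + 1)) (e + 2) τ s hs'
  rcases Nat.lt_or_ge s.card 2 with hcard | hcard
  · rcases Nat.lt_or_ge s.card 1 with hcard' | hcard'
    · simp [Nat.lt_one_iff.1 hcard']
    obtain ⟨σ, hσ⟩ := Finset.card_pos.1 hcard'
    rw [show s.card = 1 by omega, pow_one, Polynomial.dvd_iff_isRoot, Polynomial.IsRoot.def]
    have hτ : (planeCoeff h ρ 1).eval τ = 0 := by simp [planeCoeff_one, hρ]
    rw [surfaceHessian, eval_tangentHessian ρ τ (planeCoeff_one h ρ) (planeCoeff_two h ρ)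
      (planeCoeff_three h ρ) hτ]
    have c₁ := coeff_sum_aeval_mul_X_pow (fun j => planeCoeff h ρ (j + 1)) (e + 2) 1 τ σ 1
    have c₂ := coeff_sum_aeval_mul_X_pow (fun j => planeCoeff h ρ (j + 1)) (e + 2) 2 τ σ 1
    simp only [map_one, one_mul, hs' σ hσ, one_pow, mul_one, Polynomial.coeff_zero] at c₁ c₂
    rw [← Finset.sum_subset (Finset.range_mono (show 3 ≤ e + 2 + 1 by omega)) (by
      intro j _ hj; rw [if_neg]; have := Finset.mem_range.not.1 hj; omega)] at c₁ c₂
    simp [Finset.sum_range_succ, Polynomial.taylor_coeff_zero,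
      Polynomial.taylor_coeff_one] at c₁ c₂
    have hA₂ := two_mul_taylor_coeff_two (planeCoeff h ρ 1) τ
    rw [← hA₂]
    generalize (Polynomial.taylor τ (planeCoeff h ρ 1)).coeff 2 = a₂ at *
    generalize (planeCoeff h ρ 1).derivative.eval τ = a₁ at *
    rw [show (planeCoeff h ρ 2).eval τ = -(a₁ * σ) by linear_combination -c₁]
    linear_combination -2 * (sliceCoeff h 0 1).eval τ ^ 5 * a₁ ^ 2 * c₂
  · exact pow_dvd_tangentHessian ρ (planeCoeff_one h ρ) (planeCoeff_two h ρ) (planeCoeff_three h ρ)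
      hcard (hdvd 0 (by omega)) (hdvd 1 (by omega)) (hdvd 2 (by omega))

theorem card_le_natDegree_of_fiberwise_pow_dvd [DecidableEq K] {H : Polynomial K} (hH : H ≠ 0)
    {ι : Type*} (s : Finset ι) (τ : ι → K)
    (hs : ∀ t, (Polynomial.X - Polynomial.C t) ^ (s.filter (τ · = t)).card ∣ H) :
    s.card ≤ H.natDegree := by
  calc s.card = ∑ t ∈ s.image τ, (s.filter (τ · = t)).card := Finset.card_eq_sum_card_image τ s
    _ ≤ ∑ t ∈ s.image τ, H.roots.count t := Finset.sum_le_sum fun t _ => by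
        rw [Polynomial.count_roots]
        exact (Polynomial.le_rootMultiplicity_iff hH).2 (hs t)
    _ ≤ H.roots.card := by
        rw [← Multiset.toFinset_sum_count_eq]
        refine Finset.sum_le_sum_of_ne_zero fun t _ ht => ?_
        rw [Multiset.mem_toFinset]
        exact Multiset.count_ne_zero.1 ht
    _ ≤ H.natDegree := H.card_roots'

/-- The affine form of the bound: lines `x = τ + σ y, z = -ρ y` in the surface
`h (1, x, y, z) = 0`, where `z = -ρ y` is the tangent plane at `(τ, 0, 0)`. -/
theorem card_lines_le {h : MvPolynomial (Fin 4) K} {k : ℕ}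
    (hh : h.IsHomogeneous (k + 3)) (hk : ((k + 1 : ℕ) : K) ≠ 0) (hH : surfaceHessian h ≠ 0)
    (h₀ : sliceCoeff h 0 0 = 0) (ρ : K → K) (s : Finset (K × K))
    (hρ : ∀ p ∈ s, (sliceCoeff h 1 0).eval p.1 = ρ p.1 * (sliceCoeff h 0 1).eval p.1)
    (hs : ∀ p ∈ s, aeval ![1, Polynomial.C p.1 + Polynomial.C p.2 * Polynomial.X, Polynomial.X,
      -(Polynomial.C (ρ p.1) * Polynomial.X)] h = 0) :
    s.card ≤ 8 * k + 10 := by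
  classical
  refine (card_le_natDegree_of_fiberwise_pow_dvd hH s Prod.fst fun τ => ?_).trans
    (natDegree_surfaceHessian_le hh hk)
  rcases (s.filter (·.1 = τ)).eq_empty_or_nonempty with he | ⟨p, hp⟩
  · simp [he]
  have hinj : Set.InjOn Prod.snd (s.filter (·.1 = τ) : Set (K × K)) := by
    intro p hp q hq hpq
    exact Prod.ext ((Finset.mem_filter.1 hp).2.trans (Finset.mem_filter.1 hq).2.symm) hpq
  rw [← Finset.card_image_of_injOn hinj]
  obtain ⟨hps, rfl⟩ := Finset.mem_filter.1 hp
  refine X_sub_C_pow_dvd_surfaceHessian hh (by omega) h₀ p.1 (ρ p.1) (hρ p hps) _ fun σ hσ => ?_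
  obtain ⟨q, hq, rfl⟩ := Finset.mem_image.1 hσ
  obtain ⟨hq, hqp⟩ := Finset.mem_filter.1 hq
  rw [← hqp]
  exact hs q hq

end Counting

section Inflection

variable {K : Type*} [Field K]

theorem exists_binary_quadratic_eq_zero [IsAlgClosed K] (h2 : (2 : K) ≠ 0) (a b c : K) :
    ∃ u v : K, (u ≠ 0 ∨ v ≠ 0) ∧ a * u ^ 2 + b * (u * v) + c * v ^ 2 = 0 := by
  by_cases ha : a = 0
  · exact ⟨1, 0, by simp, by simp [ha]⟩
  · obtain ⟨r, hr⟩ := IsAlgClosed.exists_eq_mul_self (discrim a b c)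
    have : NeZero (2 : K) := ⟨h2⟩
    obtain ⟨x, hx⟩ := exists_quadratic_eq_zero ha ⟨r, hr⟩
    exact ⟨x, 1, by simp, by linear_combination hx⟩

theorem exists_direction_of_surfaceHessian_eval_eq_zero [IsAlgClosed K] (h2 : (2 : K) ≠ 0)
    {h : MvPolynomial (Fin 4) K} (hA : (sliceCoeff h 1 0).coeff 0 = 0)
    (hB : (sliceCoeff h 0 1).coeff 0 ≠ 0) (hH : (surfaceHessian h).coeff 0 = 0) :
    ∃ u v : K, (u ≠ 0 ∨ v ≠ 0) ∧
      (sliceCoeff h 1 0).coeff 1 * u + (sliceCoeff h 2 0).coeff 0 * v = 0 ∧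
      (sliceCoeff h 1 0).coeff 2 * u ^ 2 + (sliceCoeff h 2 0).coeff 1 * (u * v) +
        (sliceCoeff h 3 0).coeff 0 * v ^ 2 = 0 := by
  rw [Polynomial.coeff_zero_eq_eval_zero] at hB hH hA
  rw [surfaceHessian, eval_tangentHessian 0 0 (A₀ := sliceCoeff h 1 0) (C₀ := sliceCoeff h 2 0)
    (G₀ := sliceCoeff h 3 0) (by simp) (by simp) (by simp) hA, ← two_mul_taylor_coeff_two,
    Polynomial.taylor_zero, ← Polynomial.taylor_coeff_one, ← Polynomial.taylor_coeff_one,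
    Polynomial.taylor_zero, Polynomial.taylor_zero, ← Polynomial.coeff_zero_eq_eval_zero,
    ← Polynomial.coeff_zero_eq_eval_zero, ← Polynomial.coeff_zero_eq_eval_zero] at hH
  rw [← Polynomial.coeff_zero_eq_eval_zero] at hB
  replace hH := (mul_eq_zero.1 hH).resolve_left (pow_ne_zero _ hB)
  by_cases hsing : (sliceCoeff h 2 0).coeff 0 = 0 ∧ (sliceCoeff h 1 0).coeff 1 = 0
  · obtain ⟨u, v, huv, h⟩ := exists_binary_quadratic_eq_zero h2 ((sliceCoeff h 1 0).coeff 2)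
      ((sliceCoeff h 2 0).coeff 1) ((sliceCoeff h 3 0).coeff 0)
    exact ⟨u, v, huv, by simp [hsing], h⟩
  · refine ⟨(sliceCoeff h 2 0).coeff 0, -(sliceCoeff h 1 0).coeff 1, ?_, by ring, ?_⟩
    · rw [neg_ne_zero]; tauto
    · exact mul_left_cancel₀ h2 (by linear_combination hH)

theorem eval_restrictLine {n : ℕ} (g : MvPolynomial (Fin n) K) (u v : Fin n → K) (t : K) :
    (restrictLine g u v).eval t = MvPolynomial.eval (u + t • v) g := by
  have h := MvPolynomial.comp_aeval_apply
    (fun i => Polynomial.C (u i) + Polynomial.X * Polynomial.C (v i)) (Polynomial.aeval t) g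
  rw [Polynomial.coe_aeval_eq_eval] at h
  rw [restrictLine, h, MvPolynomial.aeval_eq_eval]
  congr 2
  funext i
  simp [mul_comm t]

theorem coeff_restrictLine_of_eval_eq {n : ℕ} [Infinite K] (g : MvPolynomial (Fin n) K)
    (q β γ : Fin n → K) (d : ℕ) (ψ : ℕ → Polynomial K)
    (hg : ∀ x z : K, MvPolynomial.eval (q + x • β + z • γ) g =
      ∑ j ∈ Finset.range (d + 1), (ψ j).eval x * z ^ j) (u v : K) (i : ℕ) :
    (restrictLine g q (u • β + v • γ)).coeff i = ∑ j ∈ Finset.range (d + 1), if j ≤ i then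
      (ψ j).coeff (i - j) * u ^ (i - j) * v ^ j else 0 := by
  have := coeff_sum_aeval_mul_X_pow ψ d i 0 u v
  simp only [Polynomial.taylor_zero] at this
  rw [← this]
  congr 1
  refine Polynomial.funext fun t => ?_
  rw [eval_restrictLine, smul_add, ← add_assoc, smul_smul, smul_smul, hg, Polynomial.eval_finsetSum]
  refine Finset.sum_congr rfl fun j _ => ?_
  rw [Polynomial.eval_mul, ← Polynomial.comp_eq_aeval, Polynomial.eval_comp]
  simp [mul_comm t]

end Inflection

section Geometry

variable {K : Type*} [Field K]

theorem Submodule.exists_mem_forall_notMem [Infinite K] {V : Type*} [AddCommGroup V] [Module K V]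
    {ι : Type*} (s : Finset ι) (p : ι → Submodule K V) (W : Submodule K V)
    (h : ∀ i ∈ s, ¬ W ≤ p i) : ∃ v ∈ W, ∀ i ∈ s, v ∉ p i := by
  classical
  have := Subspace.biUnion_ne_univ_of_top_notMem (k := K) (E := W)
    (s := s.image fun i => (p i).comap W.subtype) (by
      intro htop
      obtain ⟨i, hi, h'⟩ := Finset.mem_image.1 htop
      exact h i hi (Submodule.comap_subtype_eq_top.1 h'))
  obtain ⟨v, hv⟩ := (Set.ne_univ_iff_exists_notMem _).1 this
  refine ⟨v, v.2, fun i hi hvi => hv ?_⟩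
  exact Set.mem_biUnion (Finset.mem_coe.2 (Finset.mem_image_of_mem _ hi)) hvi

theorem restrictLine_eq_zero [Infinite K] {n : ℕ} {f : MvPolynomial (Fin n) K} {u v : Fin n → K}
    (h : ∀ t : K, eval (u + t • v) f = 0) : restrictLine f u v = 0 :=
  Polynomial.funext fun t => by rw [eval_restrictLine, h, Polynomial.eval_zero]

/-- The differential of `f` at `u`. -/
noncomputable def differentialAt {n : ℕ} (f : MvPolynomial (Fin n) K) (u : Fin n → K) :
    (Fin n → K) →ₗ[K] K :=
  ∑ i, eval u (pderiv i f) • LinearMap.proj i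

theorem coeff_one_restrictLine {n : ℕ} (f : MvPolynomial (Fin n) K) (u v : Fin n → K) :
    (restrictLine f u v).coeff 1 = differentialAt f u v := by
  have hd : (restrictLine f u v).derivative.eval 0 = differentialAt f u v := by
    induction f using MvPolynomial.induction_on with
    | C a => simp [restrictLine, differentialAt]
    | add p q hp hq =>
      simp only [restrictLine, differentialAt, map_add, Polynomial.eval_add, LinearMap.sum_apply,
        LinearMap.smul_apply, add_smul, Finset.sum_add_distrib, LinearMap.add_apply] at *
      rw [hp, hq]
    | mul_X p i hp =>
      have h0 := eval_restrictLine p u v 0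
      simp only [restrictLine, differentialAt, map_mul, Polynomial.derivative_mul, aeval_X,
        Polynomial.eval_add, Polynomial.eval_mul, LinearMap.sum_apply, LinearMap.smul_apply,
        pderiv_mul, pderiv_X, eval_X, LinearMap.proj_apply, smul_eq_mul, map_add] at *
      rw [hp, h0]
      simp [add_mul, Finset.sum_add_distrib, Finset.sum_mul, Pi.single_apply]
      exact Finset.sum_congr rfl fun j _ => by ring
  rw [← hd, ← Polynomial.coeff_zero_eq_eval_zero, Polynomial.coeff_derivative]
  simp

/-- The polynomial `f` in the coordinates given by the vectors `M j`. -/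
noncomputable def changeCoord {n : ℕ} (M : Fin n → Fin n → K) (f : MvPolynomial (Fin n) K) :
    MvPolynomial (Fin n) K :=
  aeval (fun i => ∑ j, C (M j i) * X j) f

theorem isHomogeneous_changeCoord {n : ℕ} (M : Fin n → Fin n → K) {f : MvPolynomial (Fin n) K}
    {d : ℕ} (hf : f.IsHomogeneous d) : (changeCoord M f).IsHomogeneous d := by
  have := hf.aeval (fun i => ∑ j, C (M j i) * X j) (n := 1) fun i =>
    IsHomogeneous.sum _ _ _ fun j _ => by
      simpa using (isHomogeneous_C _ (M j i)).mul (isHomogeneous_X K j)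
  rwa [one_mul] at this

theorem aeval_changeCoord {n : ℕ} (M : Fin n → Fin n → K) (f : MvPolynomial (Fin n) K)
    {R : Type*} [CommRing R] [Algebra K R] (r : Fin n → R) :
    aeval r (changeCoord M f) = aeval (fun i => ∑ j, algebraMap K R (M j i) * r j) f := by
  rw [changeCoord, comp_aeval_apply]
  congr 2
  funext i
  simp

variable {f : MvPolynomial (Fin 4) K} {d : ℕ}

theorem eval_eq_aeval_changeCoord (M : Fin 4 → Fin 4 → K) (f : MvPolynomial (Fin 4) K)
    (r : Fin 4 → K) :
    eval (r 0 • M 0 + r 1 • M 1 + r 2 • M 2 + r 3 • M 3) f = aeval r (changeCoord M f) := by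
  rw [aeval_changeCoord, aeval_eq_eval]
  congr 2
  funext i
  simp [Fin.sum_univ_four, mul_comm]

theorem restrictLine_eq_aeval_changeCoord (M : Fin 4 → Fin 4 → K) (f : MvPolynomial (Fin 4) K)
    (τ σ ρ : K) : restrictLine f (M 0 + τ • M 1) (σ • M 1 + M 2 - ρ • M 3) =
      aeval ![1, Polynomial.C τ + Polynomial.C σ * Polynomial.X, Polynomial.X,
        -(Polynomial.C ρ * Polynomial.X)] (changeCoord M f) := by
  rw [aeval_changeCoord, restrictLine]
  congr 2
  funext i
  simp [Fin.sum_univ_four, Polynomial.algebraMap_eq]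
  ring

theorem sliceCoeff_zero_zero_changeCoord [Infinite K] (hf : f.IsHomogeneous d)
    {M : Fin 4 → Fin 4 → K} (h : ∀ τ : K, eval (M 0 + τ • M 1) f = 0) :
    sliceCoeff (changeCoord M f) 0 0 = 0 := by
  refine Polynomial.funext fun τ => ?_
  have h₁ := aeval_eq_sum_planeCoeff (isHomogeneous_changeCoord M hf) (R := K) 0 τ 0
  have h₂ := eval_eq_aeval_changeCoord M f ![1, τ, 0, -(0 * 0)]
  rw [Finset.sum_range_succ', planeCoeff_zero] at h₁
  simp at h₁ h₂
  simp [← h₁, ← h₂, h]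

theorem differentialAt_eq_eval_planeCoeff (hf : f.IsHomogeneous d) (hd : 1 ≤ d)
    {M : Fin 4 → Fin 4 → K} (h₀ : sliceCoeff (changeCoord M f) 0 0 = 0) (τ ρ : K) :
    differentialAt f (M 0 + τ • M 1) (M 2 - ρ • M 3) =
      (planeCoeff (changeCoord M f) ρ 1).eval τ := by
  have h := restrictLine_eq_aeval_changeCoord M f τ 0 ρ
  rw [zero_smul, zero_add] at h
  obtain ⟨d, rfl⟩ := Nat.exists_eq_add_of_le' hd
  have h₁ := coeff_sum_aeval_mul_X_pow (planeCoeff (changeCoord M f) ρ) (d + 1) 1 τ 0 1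
  rw [← coeff_one_restrictLine, h]
  have h₂ := aeval_eq_sum_planeCoeff (isHomogeneous_changeCoord M hf) ρ
    (Polynomial.C τ + Polynomial.C 0 * Polynomial.X) (Polynomial.X : Polynomial K)
  rw [Polynomial.algebraMap_eq] at h₂
  simp only [Polynomial.C_1, one_mul] at h₁
  rw [h₂, h₁, ← Finset.sum_subset (Finset.range_mono (show 2 ≤ d + 1 + 1 by omega)) (by
    intro j _ hj; rw [if_neg]; have := Finset.mem_range.not.1 hj; omega)]
  simp [Finset.sum_range_succ, planeCoeff_zero, h₀, Polynomial.taylor_coeff_zero]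

theorem differentialAt_two (hf : f.IsHomogeneous d) (hd : 1 ≤ d)
    {M : Fin 4 → Fin 4 → K} (h₀ : sliceCoeff (changeCoord M f) 0 0 = 0) (τ : K) :
    differentialAt f (M 0 + τ • M 1) (M 2) = (sliceCoeff (changeCoord M f) 1 0).eval τ := by
  have := differentialAt_eq_eval_planeCoeff hf hd h₀ τ 0
  simpa [planeCoeff_one] using this

theorem differentialAt_three (hf : f.IsHomogeneous d) (hd : 1 ≤ d)
    {M : Fin 4 → Fin 4 → K} (h₀ : sliceCoeff (changeCoord M f) 0 0 = 0) (τ : K) :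
    differentialAt f (M 0 + τ • M 1) (M 3) = (sliceCoeff (changeCoord M f) 0 1).eval τ := by
  have := differentialAt_eq_eval_planeCoeff hf hd h₀ τ 1
  simpa [planeCoeff_one, differentialAt_two hf hd h₀] using this

end Geometry

section Main

variable {K : Type*} [Field K] {f : MvPolynomial (Fin 4) K} {d : ℕ}

theorem differentialAt_eq_zero_of_forall_mem [Infinite K] {W : Submodule K (Fin 4 → K)}
    (hW : ∀ v ∈ W, eval v f = 0) {u v : Fin 4 → K} (hu : u ∈ W) (hv : v ∈ W) :
    differentialAt f u v = 0 := by
  rw [← coeff_one_restrictLine, restrictLine_eq_zero fun t => hW _ (W.add_mem hu (W.smul_mem t hv)),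
    Polynomial.coeff_zero]

theorem differentialAt_ne_zero (hf : IsSmoothSurfaceOfDegree f d) {u : Fin 4 → K} (hu : u ≠ 0) :
    differentialAt f u ≠ 0 := by
  obtain ⟨i, hi⟩ := hf.2 u hu
  intro h
  apply hi
  have := LinearMap.congr_fun h (Pi.single i 1)
  simpa [differentialAt, Pi.single_apply] using this

/-- A line in the surface meeting `span {M 0, M 1}` at `M 0 + τ • M 1` is
`span {M 0 + τ • M 1, σ • M 1 + M 2 - ρ • M 3}`, where `ρ` is the slope of the tangent plane. -/
theorem exists_eq_span_of_isLineInSurface [Infinite K] (hf : f.IsHomogeneous d) (hd : 1 ≤ d)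
    {M : Fin 4 → Fin 4 → K} (hM : ⊤ ≤ Submodule.span K (Set.range M)) {W : Submodule K (Fin 4 → K)}
    (hW : Module.finrank K W = 2) (hWf : ∀ v ∈ W, eval v f = 0) (h0 : M 0 ∈ W) (h1 : M 1 ∈ W)
    {W' : Submodule K (Fin 4 → K)} (hW' : IsLineInSurface f W') (hne : W' ≠ W) {τ : K}
    (hτ : M 0 + τ • M 1 ∈ W') (hτ0 : M 0 + τ • M 1 ≠ 0)
    (hB : (sliceCoeff (changeCoord M f) 0 1).eval τ ≠ 0) :
    ∃ σ : K,
      W' = Submodule.span K {M 0 + τ • M 1, σ • M 1 + M 2 -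
        ((sliceCoeff (changeCoord M f) 1 0).eval τ / (sliceCoeff (changeCoord M f) 0 1).eval τ) •
          M 3} ∧
      aeval ![1, Polynomial.C τ + Polynomial.C σ * Polynomial.X, Polynomial.X,
        -(Polynomial.C ((sliceCoeff (changeCoord M f) 1 0).eval τ /
          (sliceCoeff (changeCoord M f) 0 1).eval τ) * Polynomial.X)] (changeCoord M f) = 0 := by
  have h₀ : sliceCoeff (changeCoord M f) 0 0 = 0 := sliceCoeff_zero_zero_changeCoord hf fun τ =>
    hWf _ (W.add_mem h0 (W.smul_mem τ h1))
  have hP : M 0 + τ • M 1 ∈ W := W.add_mem h0 (W.smul_mem τ h1)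
  obtain ⟨w, hw, hwW⟩ : ∃ w ∈ W', w ∉ W := by
    by_contra! hle
    exact hne (Submodule.eq_of_le_of_finrank_eq hle (by rw [hW, hW'.1]))
  obtain ⟨x, rfl⟩ := (Submodule.mem_span_range_iff_exists_fun K).1 (hM (Submodule.mem_top (x := w)))
  rw [Fin.sum_univ_four] at hw hwW
  have hdw := differentialAt_eq_zero_of_forall_mem hW'.2 hτ hw
  simp only [map_add, map_smul, differentialAt_eq_zero_of_forall_mem hWf hP h0,
    differentialAt_eq_zero_of_forall_mem hWf hP h1, differentialAt_two hf hd h₀,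
    differentialAt_three hf hd h₀, smul_eq_mul] at hdw
  set A := (sliceCoeff (changeCoord M f) 1 0).eval τ
  set B := (sliceCoeff (changeCoord M f) 0 1).eval τ
  have hx3 : x 3 = -(x 2 * (A / B)) := by field_simp; linear_combination hdw
  have hx2 : x 2 ≠ 0 := by
    intro h
    rw [hx3, h] at hwW
    simp only [zero_mul, neg_zero, zero_smul, add_zero] at hwW
    exact hwW (W.add_mem (W.smul_mem _ h0) (W.smul_mem _ h1))
  set σ := (x 2)⁻¹ * (x 1 - x 0 * τ)
  have hmem : σ • M 1 + M 2 - (A / B) • M 3 ∈ W' := by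
    have := W'.smul_mem (x 2)⁻¹ (W'.sub_mem hw (W'.smul_mem (x 0) hτ))
    convert! this using 1
    rw [hx3]
    funext i
    simp only [Pi.add_apply, Pi.sub_apply, Pi.smul_apply, smul_eq_mul, σ]
    field_simp
    ring
  have hnotW : σ • M 1 + M 2 - (A / B) • M 3 ∉ W := by
    intro h
    apply hwW
    have := W.add_mem (W.smul_mem (x 2) h) (W.smul_mem (x 0) hP)
    convert! this using 1
    rw [hx3]
    funext i
    simp only [Pi.add_apply, Pi.sub_apply, Pi.smul_apply, smul_eq_mul, σ]
    field_simp
    ring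
  refine ⟨σ, (Submodule.eq_of_le_of_finrank_eq ?_ ?_).symm, ?_⟩
  · rw [Submodule.span_le, Set.insert_subset_iff, Set.singleton_subset_iff]
    exact ⟨hτ, hmem⟩
  · have hli : LinearIndependent K ![M 0 + τ • M 1, σ • M 1 + M 2 - (A / B) • M 3] := by
      rw [LinearIndependent.pair_iff' hτ0]
      rintro a ha
      exact hnotW (ha ▸ W.smul_mem a hP)
    have := finrank_span_eq_card hli
    rw [Matrix.range_cons_cons_empty] at this
    rw [this, hW'.1, Fintype.card_fin]
  · rw [← restrictLine_eq_aeval_changeCoord]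
    exact restrictLine_eq_zero fun t => hW'.2 _ (W'.add_mem hτ (W'.smul_mem t hmem))

/-- If the Hessian vanishes at `M 0`, then `M 0` is an inflection point of the residual curve in
its tangent plane `span {M 0, M 1, M 2}`. -/
theorem isInflectionPointAt_of_surfaceHessian_eq_zero [IsAlgClosed K] (h2 : (2 : K) ≠ 0)
    (hf : f.IsHomogeneous d) (hd : 3 ≤ d) {M : Fin 4 → Fin 4 → K}
    (h₀ : sliceCoeff (changeCoord M f) 0 0 = 0) (hA : (sliceCoeff (changeCoord M f) 1 0).eval 0 = 0)
    (hB : (sliceCoeff (changeCoord M f) 0 1).eval 0 ≠ 0) (hH : surfaceHessian (changeCoord M f) = 0)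
    {g : MvPolynomial (Fin 3) K} {q β γ : Fin 3 → K} (hli : LinearIndependent K ![q, β, γ])
    (hg : ∀ x z : K, eval (M 0 + x • M 1 + z • M 2) f = z * eval (q + x • β + z • γ) g) :
    IsInflectionPointAt g q := by
  have : Infinite K := IsAlgClosed.instInfinite
  obtain ⟨e, rfl⟩ := Nat.exists_eq_add_of_le' hd
  have hg' : ∀ x z : K, eval (q + x • β + z • γ) g = ∑ j ∈ Finset.range (e + 2 + 1),
      (planeCoeff (changeCoord M f) 0 (j + 1)).eval x * z ^ j := by
    intro x z
    have hpoly : Polynomial.X * restrictLine g (q + x • β) γ = Polynomial.X *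
        ∑ j ∈ Finset.range (e + 2 + 1), Polynomial.C
          ((planeCoeff (changeCoord M f) 0 (j + 1)).eval x) * Polynomial.X ^ j := by
      refine Polynomial.funext fun t => ?_
      have h₁ := aeval_eq_sum_planeCoeff (isHomogeneous_changeCoord M hf) (R := K) 0 x t
      have h₃ := eval_eq_aeval_changeCoord M f ![1, x, t, -(algebraMap K K 0 * t)]
      rw [h₁, Finset.sum_range_succ', planeCoeff_zero, h₀] at h₃
      simp at h₃
      rw [Polynomial.eval_mul, Polynomial.eval_X, eval_restrictLine, ← hg, h₃]
      simp only [Polynomial.eval_mul, Polynomial.eval_X, Polynomial.eval_finsetSum, Finset.mul_sum,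
        Polynomial.eval_C, Polynomial.eval_pow]
      exact Finset.sum_congr rfl fun j _ => by ring
    have := congrArg (Polynomial.eval z) (mul_left_cancel₀ Polynomial.X_ne_zero hpoly)
    rw [eval_restrictLine] at this
    simpa [Polynomial.eval_finsetSum] using this
  rw [← Polynomial.coeff_zero_eq_eval_zero] at hA hB
  obtain ⟨u, v, huv, h₁, h₂⟩ :=
    exists_direction_of_surfaceHessian_eval_eq_zero h2 hA hB (by simp [hH])
  refine ⟨u • β + v • γ, ?_, Or.inl ?_⟩
  · rw [LinearIndependent.pair_iff]
    intro a b hab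
    have h3 := Fintype.linearIndependent_iff.1 hli ![a, b * u, b * v] (by
      rw [Fin.sum_univ_three, ← hab]
      simp [mul_smul, add_assoc])
    have ha := h3 0
    have hb := h3 1
    have hc := h3 2
    simp at ha hb hc
    refine ⟨ha, ?_⟩
    tauto
  · have hcoeff := coeff_restrictLine_of_eval_eq g q β γ (e + 2)
      (fun j => planeCoeff (changeCoord M f) 0 (j + 1)) hg' u v
    intro i hi
    rw [hcoeff, ← Finset.sum_subset (Finset.range_mono (show 3 ≤ e + 2 + 1 by omega)) (by
      intro j _ hj; rw [if_neg]; have := Finset.mem_range.not.1 hj; omega)]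
    interval_cases i
    · simp [planeCoeff_one, hA]
    · simp [Finset.sum_range_succ, planeCoeff_one, planeCoeff_two]
      linear_combination h₁
    · simp [Finset.sum_range_succ, planeCoeff_one, planeCoeff_two, planeCoeff_three]
      linear_combination h₂

theorem exists_smul_add_smul_eq_of_finrank_eq_two {V : Type*} [AddCommGroup V] [Module K V]
    {W : Submodule K V} (hW : Module.finrank K W = 2) {v₀ v u : V} (h₀ : v₀ ∈ W) (hv : v ∈ W)
    (hu : u ∈ W) (hli : LinearIndependent K ![v₀, v]) : ∃ x y : K, x • v₀ + y • v = u := by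
  have : FiniteDimensional K W := Module.finite_of_finrank_eq_succ hW
  have hspan : Submodule.span K {v₀, v} = W := by
    refine Submodule.eq_of_le_of_finrank_eq ?_ ?_
    · rw [Submodule.span_le, Set.insert_subset_iff, Set.singleton_subset_iff]
      exact ⟨h₀, hv⟩
    · have := finrank_span_eq_card hli
      rw [Matrix.range_cons_cons_empty] at this
      rw [this, hW, Fintype.card_fin]
  exact Submodule.mem_span_pair.1 (hspan ▸ hu)

theorem exists_add_smul_mem {V : Type*} [AddCommGroup V] [Module K V] {W : Submodule K V}
    (hW : Module.finrank K W = 2) {v₀ v u : V} (h₀ : v₀ ∈ W) (hv : v ∈ W) (hu : u ∈ W)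
    (hu0 : u ≠ 0) (hli : LinearIndependent K ![v₀, v]) (hvu : v ∉ Submodule.span K {u})
    {W' : Submodule K V} (huW' : u ∈ W') : ∃ τ : K, v₀ + τ • v ∈ W' := by
  obtain ⟨x, y, rfl⟩ := exists_smul_add_smul_eq_of_finrank_eq_two hW h₀ hv hu hli
  have hx : x ≠ 0 := by
    rintro rfl
    rw [zero_smul, zero_add] at hu0 hvu
    have hy : y ≠ 0 := fun h => hu0 (by rw [h, zero_smul])
    exact hvu (Submodule.mem_span_singleton.2 ⟨y⁻¹, inv_smul_smul₀ hy v⟩)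
  refine ⟨x⁻¹ * y, ?_⟩
  have := W'.smul_mem x⁻¹ huW'
  rwa [smul_add, inv_smul_smul₀ hx, smul_smul] at this

theorem card_lines_meeting_le [IsAlgClosed K] (hd : 3 ≤ d) (hchar : ringChar K = 0 ∨ d < ringChar K)
    (hf : IsSmoothSurfaceOfDegree f d) {W : Submodule K (Fin 4 → K)}
    (hW : IsLineOfFirstKind f d W) (S : Finset (Submodule K (Fin 4 → K)))
    (hS : ∀ W' ∈ S, IsLineInSurface f W' ∧ W' ≠ W ∧ W' ⊓ W ≠ ⊥) : S.card ≤ 8 * d - 14 := by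
  classical
  have : Infinite K := IsAlgClosed.instInfinite
  have hcast : ∀ m : ℕ, 0 < m → m ≤ d → (m : K) ≠ 0 := by
    intro m hm hmd h
    have hdvd := (ringChar.spec K m).1 h
    rcases hchar with h' | h'
    · rw [h', zero_dvd_iff] at hdvd; omega
    · have := Nat.le_of_dvd hm hdvd; omega
  obtain ⟨⟨hW2, hWf⟩, hfirst⟩ := hW
  simp only [SecondKindCond, not_forall] at hfirst
  obtain ⟨a, b, c, ha, hb, hli, g, -, hg, s, t, hst, hgst, hinfl⟩ := hfirst
  set P := s • a + t • b with hP
  have hPW : P ∈ W := W.add_mem (W.smul_mem s ha) (W.smul_mem t hb)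
  have hab : LinearIndependent K ![a, b] := by
    have := hli.comp ![0, 1] (by decide)
    convert! this using 1
    funext i; fin_cases i <;> rfl
  have hP0 : P ≠ 0 := by
    intro h
    have := LinearIndependent.pair_iff.1 hab s t h
    tauto
  choose! p hp hp0 using fun W' hW' => Submodule.exists_mem_ne_zero_of_ne_bot (hS W' hW').2.2
  have hspan : ∀ u : Fin 4 → K, ¬ W ≤ Submodule.span K {u} := by
    intro u h
    have h₁ := Submodule.finrank_mono h
    have h₂ := finrank_span_le_card (R := K) ({u} : Set (Fin 4 → K))
    rw [Set.toFinset_singleton, Finset.card_singleton] at h₂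
    omega
  obtain ⟨v, hvW, hv⟩ := Submodule.exists_mem_forall_notMem (insert P (S.image p))
    (fun u => Submodule.span K {u}) W fun u _ => hspan u
  have hPv : LinearIndependent K ![P, v] := by
    rw [LinearIndependent.pair_iff' hP0]
    intro r hr
    exact hv P (Finset.mem_insert_self _ _) (Submodule.mem_span_singleton.2 ⟨r, hr⟩)
  choose! τ hτ using fun W' hW' => exists_add_smul_mem hW2 hPW hvW (hp W' hW').2 (hp0 W' hW') hPv
    (hv (p W') (Finset.mem_insert_of_mem (Finset.mem_image_of_mem p hW'))) (hp W' hW').1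
  have hτ0 : ∀ r : K, P + r • v ≠ 0 := by
    intro r h
    have := LinearIndependent.pair_iff.1 hPv 1 r (by rwa [one_smul])
    exact one_ne_zero this.1
  obtain ⟨e, -, he⟩ := Submodule.exists_mem_forall_notMem (insert 0 (S.image τ))
    (fun r => LinearMap.ker (differentialAt f (P + r • v))) ⊤ (by
      intro r _ h
      exact differentialAt_ne_zero hf (hτ0 r) (LinearMap.ker_eq_top.1 (top_le_iff.1 h)))
  simp only [LinearMap.mem_ker] at he
  obtain ⟨x, y, hvxy⟩ := exists_smul_add_smul_eq_of_finrank_eq_two hW2 ha hb hvW hab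
  have hres : ∀ x' z : K, eval (P + x' • v + z • c) f =
      z * eval (![s, t, 0] + x' • ![x, y, 0] + z • ![0, 0, 1]) g := by
    intro x' z
    have := hg (s + x' * x) (t + x' * y) z
    rw [show ![s, t, 0] + x' • ![x, y, 0] + z • ![0, 0, 1] = ![s + x' * x, t + x' * y, z] by
      funext i; fin_cases i <;> simp, ← this, ← hvxy, hP]
    congr 2
    module
  have hPc : differentialAt f P c = 0 := by
    have hX : restrictLine f P c = Polynomial.X * restrictLine g ![s, t, 0] ![0, 0, 1] :=
      Polynomial.funext fun z => by
        have := hres 0 z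
        rw [zero_smul, zero_smul, add_zero, add_zero] at this
        rw [Polynomial.eval_mul, Polynomial.eval_X, eval_restrictLine, eval_restrictLine, this]
    rw [← coeff_one_restrictLine, hX, Polynomial.coeff_X_mul, Polynomial.coeff_zero_eq_eval_zero,
      eval_restrictLine, zero_smul, add_zero, hgst]
  have heP : differentialAt f P e ≠ 0 := by simpa using he 0 (Finset.mem_insert_self _ _)
  have hxy : s * y - t * x ≠ 0 := by
    intro h
    rw [LinearIndependent.pair_iff] at hPv
    have h₁ := (hPv y (-t) (by
      rw [← hvxy, hP]
      linear_combination (norm := module) h • a)).2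
    have h₂ := (hPv x (-s) (by
      rw [← hvxy, hP]
      linear_combination (norm := module) -h • b)).2
    rw [neg_eq_zero] at h₁ h₂
    tauto
  have hPvc : LinearIndependent K ![P, v, c] := by
    rw [Fintype.linearIndependent_iff]
    intro r hr
    rw [Fin.sum_univ_three] at hr
    have h₃ := Fintype.linearIndependent_iff.1 hli ![r 0 * s + r 1 * x, r 0 * t + r 1 * y, r 2] (by
      rw [Fin.sum_univ_three, ← hr]
      simp [hP, ← hvxy]
      module)
    have ha' := h₃ 0
    have hb' := h₃ 1
    have hc' := h₃ 2
    simp at ha' hb' hc'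
    have hr0 : r 0 = 0 := (mul_eq_zero.1 (by linear_combination y * ha' - x * hb' :
      (s * y - t * x) * r 0 = 0)).resolve_left hxy
    have hr1 : r 1 = 0 := (mul_eq_zero.1 (by linear_combination s * hb' - t * ha' :
      (s * y - t * x) * r 1 = 0)).resolve_left hxy
    intro i
    fin_cases i
    exacts [hr0, hr1, hc']
  set M : Fin 4 → Fin 4 → K := ![P, v, c, e] with hMdef
  have hM : LinearIndependent K M := by
    rw [Fintype.linearIndependent_iff]
    intro r hr
    rw [Fin.sum_univ_four] at hr
    have hr3 := congrArg (differentialAt f P) hr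
    simp [hMdef, differentialAt_eq_zero_of_forall_mem hWf hPW hPW,
      differentialAt_eq_zero_of_forall_mem hWf hPW hvW, hPc, heP] at hr3
    have h₃ := Fintype.linearIndependent_iff.1 hPvc ![r 0, r 1, r 2] (by
      rw [Fin.sum_univ_three, ← hr, hr3]
      simp [hMdef])
    intro i
    fin_cases i
    exacts [h₃ 0, h₃ 1, h₃ 2, hr3]
  have hMtop : ⊤ ≤ Submodule.span K (Set.range M) :=
    (hM.span_eq_top_of_card_eq_finrank (by simp)).ge
  have h₀ : sliceCoeff (changeCoord M f) 0 0 = 0 := sliceCoeff_zero_zero_changeCoord hf.1 fun r =>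
    hWf _ (W.add_mem hPW (W.smul_mem r hvW))
  have hA0 : (sliceCoeff (changeCoord M f) 1 0).eval 0 = 0 := by
    rw [← differentialAt_two hf.1 (by omega) h₀]
    simpa [hMdef] using hPc
  have hB0 : (sliceCoeff (changeCoord M f) 0 1).eval 0 ≠ 0 := by
    rw [← differentialAt_three hf.1 (by omega) h₀]
    simpa [hMdef] using heP
  have hli₃ : LinearIndependent K ![![s, t, 0], ![x, y, 0], ![0, 0, 1]] := by
    refine Matrix.linearIndependent_rows_of_det_ne_zero (A := !![s, t, 0; x, y, 0; 0, 0, 1]) ?_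
    rw [Matrix.det_fin_three]
    simpa using hxy
  have hH : surfaceHessian (changeCoord M f) ≠ 0 := fun hH => hinfl <|
    isInflectionPointAt_of_surfaceHessian_eq_zero (hcast 2 (by omega) (by omega)) hf.1 hd h₀ hA0
      hB0 hH (β := ![x, y, 0]) (γ := ![0, 0, 1]) hli₃ hres
  have hB : ∀ W' ∈ S, (sliceCoeff (changeCoord M f) 0 1).eval (τ W') ≠ 0 := by
    intro W' hW'
    rw [← differentialAt_three hf.1 (by omega) h₀]
    exact he (τ W') (Finset.mem_insert_of_mem (Finset.mem_image_of_mem τ hW'))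
  choose! σ hσspan hσ using fun W' hW' => exists_eq_span_of_isLineInSurface hf.1 (by omega) hMtop hW2
    hWf hPW hvW (hS W' hW').1 (hS W' hW').2.1 (hτ W' hW') (hτ0 _) (hB W' hW')
  have hinj : Set.InjOn (fun W' => (τ W', σ W')) (S : Set (Submodule K (Fin 4 → K))) := by
    intro W₁ h₁ W₂ h₂ h
    obtain ⟨hτ₁₂, hσ₁₂⟩ := Prod.mk.inj h
    rw [hσspan W₁ h₁, hσspan W₂ h₂, hτ₁₂, hσ₁₂]
  rw [← Finset.card_image_of_injOn hinj]
  obtain ⟨k, rfl⟩ := Nat.exists_eq_add_of_le' hd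
  refine (card_lines_le (isHomogeneous_changeCoord M hf.1) (hcast (k + 1) (by omega) (by omega)) hH
    h₀ (fun r => (sliceCoeff (changeCoord M f) 1 0).eval r /
      (sliceCoeff (changeCoord M f) 0 1).eval r) _ ?_ ?_).trans (by omega)
  · intro q hq
    obtain ⟨W', hW', rfl⟩ := Finset.mem_image.1 hq
    exact (div_mul_cancel₀ _ (hB W' hW')).symm
  · intro q hq
    obtain ⟨W', hW', rfl⟩ := Finset.mem_image.1 hq
    exact hσ W' hW'

end Main

theorem first_kind_meets_few_lines
    {K : Type*} [Field K] [IsAlgClosed K] (d : ℕ) (hd : 3 ≤ d)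
    (hchar : ringChar K = 0 ∨ d < ringChar K)
    (f : MvPolynomial (Fin 4) K) (hf : IsSmoothSurfaceOfDegree f d)
    (W : Submodule K (Fin 4 → K)) (hW : IsLineOfFirstKind f d W) :
    {W' : Submodule K (Fin 4 → K) | IsLineInSurface f W' ∧ W' ≠ W ∧ W' ⊓ W ≠ ⊥}.Finite ∧
      {W' : Submodule K (Fin 4 → K) | IsLineInSurface f W' ∧ W' ≠ W ∧ W' ⊓ W ≠ ⊥}.ncard ≤
        8 * d - 14 := by
  have hcard := card_lines_meeting_le hd hchar hf hW
  have hfin : {W' : Submodule K (Fin 4 → K) |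
      IsLineInSurface f W' ∧ W' ≠ W ∧ W' ⊓ W ≠ ⊥}.Finite := by
    by_contra hinf
    obtain ⟨S, hS, hSc⟩ := Set.Infinite.exists_subset_card_eq hinf (8 * d - 14 + 1)
    have := hcard S fun W' hW' => hS hW'
    omega
  refine ⟨hfin, ?_⟩
  rw [Set.ncard_eq_toFinset_card _ hfin]
  exact hcard _ fun W' hW' => hfin.mem_toFinset.1 hW'
end

section
/- Let X = {f = 0} ⊂ P³(K) be a smooth surface of degree d ≥ 3 over an algebraically closed field K of characteristic 0 or of characteristic p > d. Let P ∈ X and let L be a line with P ∈ L and i(P, L.X) ≥ 3, and suppose that t_P^(3) does not vanish identically on L. Then P is the unique zero of t_P^(3) restricted to L; more precisely, under any linear parametrization of L, t_P^(3)|_L is a nonzero scalar multiple of the cube of a linear form vanishing exactly at P (t_P^(3)|_L has a triple root at P). -/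
open MvPolynomial

/-- The form `t_P^{(j)}(z) = ∑_{0 ≤ i₁,…,i_j ≤ 3} (∂^j f/∂w_{i₁}⋯∂w_{i_j})(P) · z_{i₁}⋯z_{i_j}`. -/
noncomputable def tForm {K : Type*} [CommSemiring K]
    (f : MvPolynomial (Fin 4) K) (j : ℕ) (P : Fin 4 → K) : MvPolynomial (Fin 4) K :=
  ∑ s : Fin j → Fin 4,
    MvPolynomial.C
        (MvPolynomial.eval P ((List.ofFn s).foldr (fun i g => MvPolynomial.pderiv i g) f)) *
      ∏ a : Fin j, MvPolynomial.X (s a)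

namespace MvPolynomial

variable {σ K : Type*} [Fintype σ] [CommRing K]

/-- The derivative of a polynomial in the constant direction `z`. -/
noncomputable def dirDeriv (z : σ → K) : Derivation K (MvPolynomial σ K) (MvPolynomial σ K) :=
  ∑ i, z i • pderiv i

theorem dirDeriv_apply (z : σ → K) (g : MvPolynomial σ K) :
    dirDeriv z g = ∑ i, C (z i) * pderiv i g := by
  have h := congrFun (map_sum Derivation.coeFnAddMonoidHom (fun i => z i • pderiv i)
    (Finset.univ : Finset σ)) g
  rw [Finset.sum_apply] at h
  exact h.trans (Finset.sum_congr rfl fun i _ => smul_eq_C_mul _ _)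

theorem dirDeriv_X (z : σ → K) (i : σ) : dirDeriv z (X i) = C (z i) := by
  classical simp [dirDeriv_apply, pderiv_X, Pi.single_apply]

theorem dirDeriv_smul_add_smul (s t : K) (u v : σ → K) (g : MvPolynomial σ K) :
    dirDeriv (s • u + t • v) g = C s * dirDeriv u g + C t * dirDeriv v g := by
  simp only [dirDeriv_apply, Finset.mul_sum, ← Finset.sum_add_distrib]
  exact Finset.sum_congr rfl fun i _ => by simp; ring

theorem dirDeriv_comm (u v : σ → K) (g : MvPolynomial σ K) :
    dirDeriv u (dirDeriv v g) = dirDeriv v (dirDeriv u g) := by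
  have h : ⁅dirDeriv u, dirDeriv v⁆ = 0 :=
    derivation_ext fun i => by simp [Derivation.commutator_apply, dirDeriv_X]
  rw [← sub_eq_zero, ← Derivation.commutator_apply, h, Derivation.zero_apply]

theorem IsHomogeneous.dirDeriv {g : MvPolynomial σ K} {n : ℕ} (hg : g.IsHomogeneous n)
    (z : σ → K) : (dirDeriv z g).IsHomogeneous (n - 1) := by
  rw [dirDeriv_apply]
  exact IsHomogeneous.sum _ _ _ fun i _ => hg.pderiv.C_mul (z i)

/-- Euler's identity: differentiating a form at a point in the direction of that point. -/
theorem IsHomogeneous.eval_dirDeriv_self {g : MvPolynomial σ K} {n : ℕ}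
    (hg : g.IsHomogeneous n) (u : σ → K) :
    eval u (MvPolynomial.dirDeriv u g) = n * eval u g := by
  have h := congrArg (eval u) hg.sum_X_mul_pderiv
  simpa [dirDeriv_apply] using h

end MvPolynomial

theorem derivative_restrictLine {K : Type*} [CommRing K] {n : ℕ}
    (g : MvPolynomial (Fin n) K) (u v : Fin n → K) :
    Polynomial.derivative (restrictLine g u v) = restrictLine (dirDeriv v g) u v := by
  unfold restrictLine
  induction g using MvPolynomial.induction_on with
  | C a => simp [← MvPolynomial.algebraMap_eq]
  | add p q hp hq => simp only [map_add, hp, hq]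
  | mul_X p i hp =>
    simp only [map_mul, map_add, Derivation.leibniz, dirDeriv_X, smul_eq_mul, aeval_X, aeval_C,
      Polynomial.derivative_mul, Polynomial.derivative_C, Polynomial.derivative_X,
      Polynomial.algebraMap_eq, hp]
    ring

theorem coeff_zero_restrictLine {K : Type*} [CommRing K] {n : ℕ}
    (g : MvPolynomial (Fin n) K) (u v : Fin n → K) :
    (restrictLine g u v).coeff 0 = eval u g := by
  rw [Polynomial.coeff_zero_eq_eval_zero]
  unfold restrictLine
  induction g using MvPolynomial.induction_on with
  | C a => simp
  | add p q hp hq => simp only [map_add, Polynomial.eval_add, hp, hq]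
  | mul_X p i hp => simp [hp, -Polynomial.X_mul_C]

theorem ordGE.dirDeriv {K : Type*} [CommRing K] {n k : ℕ}
    {g : MvPolynomial (Fin n) K} {u v : Fin n → K} (h : ordGE g u v (k + 1)) :
    ordGE (dirDeriv v g) u v k := fun j hj => by
  rw [← derivative_restrictLine, Polynomial.coeff_derivative, h (j + 1) (by omega), zero_mul]

theorem ordGE.eval_eq_zero {K : Type*} [CommRing K] {n k : ℕ}
    {g : MvPolynomial (Fin n) K} {u v : Fin n → K} (h : ordGE g u v (k + 1)) :
    eval u g = 0 := by
  rw [← coeff_zero_restrictLine g u v]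
  exact h 0 k.succ_pos

theorem iterate_dirDeriv {K : Type*} [CommRing K] (f : MvPolynomial (Fin 4) K) (z : Fin 4 → K)
    (j : ℕ) :
    (dirDeriv z)^[j] f = ∑ s : Fin j → Fin 4,
      C (∏ a, z (s a)) * (List.ofFn s).foldr (fun i g => pderiv i g) f := by
  induction j with
  | zero => simp
  | succ j ih =>
    rw [Function.iterate_succ_apply', ih, dirDeriv_apply,
      ← (Fin.consEquiv fun _ : Fin (j + 1) => Fin 4).sum_comp, Fintype.sum_prod_type]
    refine Finset.sum_congr rfl fun i _ => ?_
    rw [map_sum, Finset.mul_sum]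
    refine Finset.sum_congr rfl fun s _ => ?_
    rw [pderiv_C_mul, ← mul_assoc, ← C_mul]
    simp only [Fin.consEquiv_apply, Fin.prod_univ_succ, List.ofFn_succ, Fin.cons_zero,
      Fin.cons_succ, List.foldr_cons]

theorem eval_tForm {K : Type*} [CommRing K] (f : MvPolynomial (Fin 4) K) (j : ℕ)
    (P z : Fin 4 → K) : eval z (tForm f j P) = eval P ((dirDeriv z)^[j] f) := by
  simp [tForm, iterate_dirDeriv, mul_comm]

theorem t3_restriction_triple_root
    {K : Type*} [Field K] [IsAlgClosed K] (d : ℕ) (hd : 3 ≤ d)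
    (hchar : ringChar K = 0 ∨ d < ringChar K)
    (f : MvPolynomial (Fin 4) K) (hf : IsSmoothSurfaceOfDegree f d)
    (u v : Fin 4 → K) (hu : u ≠ 0) (huX : MvPolynomial.eval u f = 0)
    (hli : LinearIndependent K ![u, v]) (h3 : ordGE f u v 3)
    (hnv : ¬ ∀ z ∈ Submodule.span K {u, v}, MvPolynomial.eval z (tForm f 3 u) = 0) :
    ∃ c : K, c ≠ 0 ∧
      ∀ s t : K, MvPolynomial.eval (s • u + t • v) (tForm f 3 u) = c * t ^ 3 := by
  have h0 := h3.eval_eq_zero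
  have h1 := h3.dirDeriv.eval_eq_zero
  have h2 := h3.dirDeriv.dirDeriv.eval_eq_zero
  have hf' := hf.1
  have key : ∀ s t : K, eval (s • u + t • v) (tForm f 3 u) =
      eval u (dirDeriv v (dirDeriv v (dirDeriv v f))) * t ^ 3 := by
    intro s t
    rw [eval_tForm]
    simp only [Function.iterate_succ_apply, Function.iterate_zero_apply, dirDeriv_smul_add_smul,
      map_add, Derivation.leibniz, derivation_C, smul_eq_mul, mul_zero, add_zero, map_mul, eval_C,
      dirDeriv_comm v u, hf'.eval_dirDeriv_self, (hf'.dirDeriv _).eval_dirDeriv_self,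
      ((hf'.dirDeriv _).dirDeriv _).eval_dirDeriv_self, h0, h1, h2]
    ring
  refine ⟨_, fun hc => hnv fun z hz => ?_, key⟩
  obtain ⟨s, t, rfl⟩ := Submodule.mem_span_pair.mp hz
  rw [key, hc, zero_mul]
end
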